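/- Explicit worst-case competitive ratio under mean–variance–support information: Let 0 < μ < β and 0 < σ² < μ(β−μ), set τ₁ = μ − σ²/(β−μ) and τ₂ = μ + σ²/μ, and let 𝒫(μ,σ,β) be the set of Borel probability measures P on ℝ with P([0,β]) = 1, ∫ x dP = μ and ∫ x² dP = μ² + σ². Then for every p ∈ (0,β], inf_{P ∈ 𝒫(μ,σ,β)} CR(p,P) equals min{ (μ−p)²/((μ−p)² + σ²), p(μ−p)/(μ(μ−p) + σ²) } for p ∈ (0,τ₁], equals min{ p(μ² + σ² − pμ)/((β−p)(μ(β+p−μ) − σ²)), p/β } for p ∈ [τ₁,τ₂], and equals 0 for p ∈ [τ₂,β]. -/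

import Mathlib

open MeasureTheory Set

/-- Tail probability `P(X ≥ p) = P([p,∞))` as a real number. -/
noncomputable def tail (P : Measure ℝ) (p : ℝ) : ℝ := (P (Ici p)).toReal

/-- Revenue `REV(p,P) = p · P(X ≥ p)`. -/
noncomputable def REV (p : ℝ) (P : Measure ℝ) : ℝ := p * tail P p

/-- Optimal revenue `OPT(P) = sup_{t>0} t · P(X ≥ t)`. -/
noncomputable def OPT (P : Measure ℝ) : ℝ := ⨆ t : Ioi (0:ℝ), (t : ℝ) * tail P (t : ℝ)

/-- Competitive ratio `CR(p,P) = REV(p,P)/OPT(P)`. -/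
noncomputable def CR (p : ℝ) (P : Measure ℝ) : ℝ := REV p P / OPT P

/-- The mean–variance–support ambiguity set `𝒫(μ,σ,β)`: Borel probability measures on `ℝ`
supported in `[0,β]`, with mean `μ` and second moment `μ² + σ²`. -/
def ambV (μ σ β : ℝ) : Set (Measure ℝ) :=
  {P | IsProbabilityMeasure P ∧ P (Icc 0 β) = 1 ∧ (∫ x, x ∂P) = μ ∧
        (∫ x, x ^ 2 ∂P) = μ ^ 2 + σ ^ 2}


lemma aux_int {P : Measure ℝ} [IsProbabilityMeasure P] {β : ℝ} (h : P (Icc 0 β) = 1)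
    {f : ℝ → ℝ} (hf : Continuous f) : Integrable f P := by
  have hae : ∀ᵐ x ∂P, x ∈ Icc 0 β := by
    rw [← prob_compl_eq_zero_iff measurableSet_Icc] at h
    exact h
  obtain ⟨C, hC⟩ := (isCompact_Icc (a := (0:ℝ)) (b := β)).exists_bound_of_continuousOn hf.continuousOn
  exact Integrable.of_bound hf.aestronglyMeasurable C (hae.mono fun x hx => hC x hx)

lemma aux_ineq {μ σ β : ℝ} {P : Measure ℝ} (hP : P ∈ ambV μ σ β) (c0 c1 c2 d t : ℝ)
    (h1 : ∀ x, 0 ≤ x → x ≤ β → x < t → c0 + c1 * x + c2 * x ^ 2 ≤ 0)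
    (h2 : ∀ x, 0 ≤ x → x ≤ β → t ≤ x → c0 + c1 * x + c2 * x ^ 2 ≤ d) :
    c0 + c1 * μ + c2 * (μ ^ 2 + σ ^ 2) ≤ d * tail P t := by
  obtain ⟨hp, hs, hm, hv⟩ := hP
  have hae : ∀ᵐ x ∂P, x ∈ Icc 0 β := by
    have h := hs
    rw [← prob_compl_eq_zero_iff measurableSet_Icc] at h
    exact h
  have e1 : ∫ x, (c0 + c1 * x + c2 * x ^ 2) ∂P = c0 + c1 * μ + c2 * (μ ^ 2 + σ ^ 2) := by
    rw [integral_add (aux_int hs (by fun_prop)) (aux_int hs (by fun_prop)),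
      integral_add (aux_int hs (by fun_prop)) (aux_int hs (by fun_prop)),
      integral_const_mul, integral_const_mul, hm, hv]
    simp
  have e2 : ∫ x, (Ici t).indicator (fun _ => d) x ∂P = d * tail P t := by
    rw [integral_indicator_const _ measurableSet_Ici]
    simp [tail, Measure.real, mul_comm]
  rw [← e1, ← e2]
  refine integral_mono_ae (aux_int hs (by fun_prop))
    ((integrable_const d).indicator measurableSet_Ici) ?_
  filter_upwards [hae] with x hx
  by_cases hxt : t ≤ x
  · simpa [indicator, hxt] using h2 x hx.1 hx.2 hxt
  · simpa [indicator, hxt] using h1 x hx.1 hx.2 (not_le.1 hxt)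

lemma tail_nonneg' (P : Measure ℝ) (t : ℝ) : 0 ≤ tail P t := ENNReal.toReal_nonneg

lemma tail_anti {μ σ β : ℝ} {P : Measure ℝ} (hP : P ∈ ambV μ σ β) {s t : ℝ} (h : s ≤ t) :
    tail P t ≤ tail P s := by
  haveI := hP.1
  exact ENNReal.toReal_mono (measure_ne_top _ _) (measure_mono (Ici_subset_Ici.2 h))

lemma tail_gt {μ σ β : ℝ} {P : Measure ℝ} (hP : P ∈ ambV μ σ β) {t : ℝ} (h : β < t) :
    tail P t = 0 := by
  have := aux_ineq hP 0 0 0 (-1) t (by intros; simp) (by intros; linarith)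
  have := tail_nonneg' P t
  linarith

lemma OPT_bdd {μ σ β : ℝ} {P : Measure ℝ} (hP : P ∈ ambV μ σ β) (hβ : 0 < β) :
    BddAbove (range fun t : Ioi (0:ℝ) => (t : ℝ) * tail P (t : ℝ)) := by
  refine ⟨β, ?_⟩
  rintro _ ⟨⟨t, ht⟩, rfl⟩
  have ht : 0 < t := ht
  have h := aux_ineq hP 0 (-1) 0 (-t) t (by intros; linarith) (by intros; linarith)
  have h' := aux_ineq hP (-β) 1 0 0 0 (by intros; linarith) (by intros; linarith)
  simp only
  linarith

lemma le_OPT {μ σ β : ℝ} {P : Measure ℝ} (hP : P ∈ ambV μ σ β) (hβ : 0 < β) {t : ℝ} (ht : 0 < t) :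
    t * tail P t ≤ OPT P :=
  le_ciSup (OPT_bdd hP hβ) (⟨t, ht⟩ : Ioi (0:ℝ))

lemma OPT_nonneg (P : Measure ℝ) : 0 ≤ OPT P :=
  Real.iSup_nonneg fun t => mul_nonneg (le_of_lt t.2) (tail_nonneg' _ _)

lemma CR_nonneg (P : Measure ℝ) {p : ℝ} (hp : 0 < p) : 0 ≤ CR p P :=
  div_nonneg (mul_nonneg hp.le (tail_nonneg' _ _)) (OPT_nonneg P)

lemma OPT_pos {μ σ β : ℝ} {P : Measure ℝ} (hP : P ∈ ambV μ σ β) (hβ : 0 < β) (hμ : 0 < μ) :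
    0 < OPT P := by
  have h := aux_ineq hP (-(μ/2)) 1 0 β (μ/2) (by intros; linarith) (by intros; linarith)
  have h2 := le_OPT hP hβ (half_pos hμ)
  have h3 : 0 < tail P (μ/2) := by
    by_contra hc
    have : β * tail P (μ/2) ≤ 0 := mul_nonpos_of_nonneg_of_nonpos hβ.le (not_lt.1 hc)
    linarith
  exact lt_of_lt_of_le (mul_pos (half_pos hμ) h3) h2

lemma le_CR {μ σ β : ℝ} {P : Measure ℝ} (hP : P ∈ ambV μ σ β) (hβ : 0 < β) (hμ : 0 < μ)
    {m p : ℝ} (hp : 0 < p) (hm : 0 ≤ m)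
    (h : ∀ t, 0 < t → t ≤ β → m * (t * tail P t) ≤ p * tail P p) : m ≤ CR p P := by
  unfold CR
  rw [le_div_iff₀ (OPT_pos hP hβ hμ)]
  rcases hm.eq_or_lt with rfl | hm
  · rw [zero_mul]; exact mul_nonneg hp.le (tail_nonneg' _ _)
  · rw [mul_comm, ← le_div_iff₀ hm]
    haveI : Nonempty (Ioi (0:ℝ)) := ⟨⟨1, mem_Ioi.2 one_pos⟩⟩
    refine ciSup_le ?_
    rintro ⟨t, ht⟩
    rw [le_div_iff₀ hm, mul_comm]
    by_cases htb : t ≤ β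
    · exact h t ht htb
    · simp only [tail_gt hP (not_le.1 htb), mul_zero]
      exact mul_nonneg hp.le (tail_nonneg' _ _)

lemma exists_meas {μ σ β a b c y z : ℝ} (ha : 0 ≤ a) (hb : 0 ≤ b) (hc : 0 ≤ c)
    (h1 : a + b + c = 1) (hm : b * y + c * z = μ) (hv : b * y ^ 2 + c * z ^ 2 = μ ^ 2 + σ ^ 2)
    (hy : 0 < y) (hyb : y ≤ β) (hz : 0 < z) (hzb : z ≤ β) :
    ∃ P ∈ ambV μ σ β, ∀ t, 0 < t →
      tail P t = (if t ≤ y then b else 0) + (if t ≤ z then c else 0) := by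
  have hβ : 0 ≤ β := by linarith
  let P : Measure ℝ := ENNReal.ofReal a • Measure.dirac 0 + ENNReal.ofReal b • Measure.dirac y
    + ENNReal.ofReal c • Measure.dirac z
  have hint : ∀ f : ℝ → ℝ, Continuous f → ∫ x, f x ∂P = a * f 0 + b * f y + c * f z := by
    intro f hf
    have i : ∀ (r w : ℝ), Integrable f (ENNReal.ofReal r • Measure.dirac w) := fun r w =>
      (integrable_dirac (by simp)).smul_measure ENNReal.ofReal_ne_top
    rw [integral_add_measure ((i _ _).add_measure (i _ _)) (i _ _),
      integral_add_measure (i _ _) (i _ _)]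
    simp [integral_smul_measure, ha, hb, hc]
  have hsum : ENNReal.ofReal a + ENNReal.ofReal b + ENNReal.ofReal c = 1 := by
    rw [← ENNReal.ofReal_add ha hb, ← ENNReal.ofReal_add (by positivity) hc, h1, ENNReal.ofReal_one]
  refine ⟨P, ⟨⟨?_⟩, ?_, ?_, ?_⟩, ?_⟩
  · simp [P, hsum]
  · simp [P, hβ, hy.le, hyb, hz.le, hzb, hsum]
  · rw [hint _ continuous_id']; linarith
  · rw [hint _ (by fun_prop)]; linarith
  · intro t ht
    have : P (Ici t) = ENNReal.ofReal ((if t ≤ y then b else 0) + (if t ≤ z then c else 0)) := by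
      rw [ENNReal.ofReal_add (by split_ifs <;> simp [hb]) (by split_ifs <;> simp [hc])]
      simp only [P, Measure.add_apply, Measure.smul_apply, smul_eq_mul,
        Measure.dirac_apply' _ measurableSet_Ici, indicator, mem_Ici, not_le.2 ht, if_false]
      split_ifs <;> simp_all
    rw [tail, this, ENNReal.toReal_ofReal]
    exact add_nonneg (by split_ifs <;> simp [hb]) (by split_ifs <;> simp [hc])

lemma sInf_le_CR {μ σ β p : ℝ} {P : Measure ℝ} (hP : P ∈ ambV μ σ β) (hp : 0 < p) :
    sInf ((fun P => CR p P) '' ambV μ σ β) ≤ CR p P := by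
  refine csInf_le ⟨0, ?_⟩ ⟨P, hP, rfl⟩
  rintro _ ⟨Q, _, rfl⟩
  exact CR_nonneg Q hp

lemma upper {μ σ β p a b c y z : ℝ} (ha : 0 ≤ a) (hb : 0 ≤ b) (hc : 0 < c)
    (h1 : a + b + c = 1) (hm : b * y + c * z = μ) (hv : b * y ^ 2 + c * z ^ 2 = μ ^ 2 + σ ^ 2)
    (hy : 0 < y) (hyp : y < p) (hpz : p ≤ z) (hzb : z ≤ β) :
    sInf ((fun P => CR p P) '' ambV μ σ β) ≤ min (p * c / (y * (b + c))) (p / z) := by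
  have hp : 0 < p := hy.trans hyp
  have hz : 0 < z := by linarith
  have hβ : 0 < β := by linarith
  obtain ⟨P, hP, ht⟩ := exists_meas ha hb hc.le h1 hm hv hy (by linarith) hz hzb
  refine (sInf_le_CR hP hp).trans ?_
  have t1 : tail P p = c := by rw [ht p hp]; simp [hpz, hyp]
  have t2 : tail P y = b + c := by rw [ht y hy]; simp [(hyp.le.trans hpz)]
  have t3 : tail P z = c := by rw [ht z hz]; simp [(hyp.trans_le hpz)]
  have o1 := le_OPT hP hβ hy
  have o2 := le_OPT hP hβ hz
  rw [t2] at o1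
  rw [t3] at o2
  have hcz : 0 < z * c := by positivity
  have hcy : 0 < y * (b + c) := by positivity
  unfold CR REV
  rw [t1]
  refine le_min ?_ ?_
  · exact div_le_div_of_nonneg_left (by positivity) hcy o1
  · calc p * c / OPT P ≤ p * c / (z * c) := div_le_div_of_nonneg_left (by positivity) hcz o2
      _ = p / z := by field_simp

lemma lim_upper {S l p : ℝ} (g : ℝ → ℝ) (hlp : l < p) (hg : ContinuousAt g p)
    (h : ∀ y, l < y → y < p → S ≤ g y) : S ≤ g p := by
  refine ge_of_tendsto (hg.tendsto.mono_left (nhdsWithin_le_nhds (s := Iio p))) ?_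
  filter_upwards [Ioo_mem_nhdsLT hlp] with y hy using h y hy.1 hy.2

lemma nonempty_amb {μ β σ : ℝ} (hμ : 0 < μ) (hμβ : μ < β) (hσ : 0 < σ)
    (hσub : σ ^ 2 < μ * (β - μ)) : ∃ P ∈ ambV μ σ β, ∀ t, μ + σ ^ 2 / μ < t → tail P t = 0 := by
  have hz : μ + σ ^ 2 / μ ≤ β := by
    have : σ ^ 2 / μ ≤ β - μ := by rw [div_le_iff₀ hμ]; linarith
    linarith
  have hz0 : 0 < μ + σ ^ 2 / μ := by positivity
  obtain ⟨P, hP, h⟩ := exists_meas (μ := μ) (σ := σ) (β := β) (a := σ ^ 2 / (μ ^ 2 + σ ^ 2)) (b := 0)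
    (c := μ ^ 2 / (μ ^ 2 + σ ^ 2)) (y := β) (z := μ + σ ^ 2 / μ) (by positivity) le_rfl
    (by positivity) (by field_simp; ring) (by field_simp; ring) (by field_simp; ring) (by linarith) le_rfl hz0 hz
  refine ⟨P, hP, fun t ht => ?_⟩
  rw [h t (by linarith)]
  simp [not_le.2 ht]

lemma caseA {μ β σ p : ℝ} (hμ : 0 < μ) (hμβ : μ < β) (hσ : 0 < σ) (hσub : σ ^ 2 < μ * (β - μ))
    (hp : 0 < p) (hp1 : p ≤ μ - σ ^ 2 / (β - μ)) :
    sInf ((fun P => CR p P) '' ambV μ σ β) =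
          min ((μ - p) ^ 2 / ((μ - p) ^ 2 + σ ^ 2))
              (p * (μ - p) / (μ * (μ - p) + σ ^ 2)) := by
  have hβμ : 0 < β - μ := by linarith
  have hβ : 0 < β := by linarith
  have hs : σ ^ 2 ≤ (μ - p) * (β - μ) := by
    rw [← div_le_iff₀ hβμ]; linarith
  have hu : 0 < μ - p := by
    have : 0 < σ ^ 2 / (β - μ) := by positivity
    linarith
  apply le_antisymm
  · have key := lim_upper (S := sInf ((fun P => CR p P) '' ambV μ σ β)) (l := 0) (p := p)
      (fun y => min (p * ((μ - y) ^ 2 / ((μ - y) ^ 2 + σ ^ 2)) /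
        (y * (σ ^ 2 / ((μ - y) ^ 2 + σ ^ 2) + (μ - y) ^ 2 / ((μ - y) ^ 2 + σ ^ 2))))
        (p / (μ + σ ^ 2 / (μ - y)))) hp ?_ ?_
    · refine key.trans (le_of_eq ?_)
      congr 1
      · field_simp
        ring
      · field_simp
    · have e1 : (μ - p) ^ 2 + σ ^ 2 ≠ 0 := by positivity
      have e2 : μ - p ≠ 0 := hu.ne'
      have e3 : μ + σ ^ 2 / (μ - p) ≠ 0 := by positivity
      have e4 : p * (σ ^ 2 / ((μ - p) ^ 2 + σ ^ 2) + (μ - p) ^ 2 / ((μ - p) ^ 2 + σ ^ 2)) ≠ 0 := by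
        positivity
      fun_prop (disch := assumption)
    · intro y hy hyp
      have hu' : 0 < μ - y := by linarith
      have hz : σ ^ 2 / (μ - y) ≤ β - μ := by
        rw [div_le_iff₀ hu']
        nlinarith
      have hz0 : 0 < σ ^ 2 / (μ - y) := by positivity
      refine upper (a := 0) le_rfl (by positivity) (by positivity) ?_ ?_ ?_ hy hyp
        (by linarith) (by linarith)
      · field_simp; ring
      · field_simp; ring
      · field_simp; ring
  · obtain ⟨P0, hP0, -⟩ := nonempty_amb hμ hμβ hσ hσub
    refine le_csInf ⟨_, P0, hP0, rfl⟩ ?_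
    rintro _ ⟨P, hP, rfl⟩
    obtain ⟨s, hsdef⟩ : ∃ s, s = σ ^ 2 / (μ - p) := ⟨_, rfl⟩
    have hs0 : 0 < s := by rw [hsdef]; positivity
    have hσs : σ ^ 2 = (μ - p) * s := by rw [hsdef]; field_simp
    obtain ⟨u, hudef⟩ : ∃ u, u = μ - p := ⟨_, rfl⟩
    have hμu : μ = p + u := by linarith
    rw [← hudef] at hu hσs
    have f1 : (μ - p) ^ 2 / ((μ - p) ^ 2 + σ ^ 2) = u / (u + s) := by
      rw [hσs, ← hudef]; field_simp
    have f2 : p * (μ - p) / (μ * (μ - p) + σ ^ 2) = p / (μ + s) := by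
      rw [hσs, ← hudef]; field_simp
    rw [f1, f2]
    have hT := tail_nonneg' P p
    have q1 : u / (u + s) ≤ tail P p := by
      have h := aux_ineq hP ((u + s) ^ 2 - (μ + s) ^ 2) (2 * (μ + s)) (-1) ((u + s) ^ 2) p
        (by intro x _ _ hx; rw [hμu]; nlinarith) (by intro x _ _ hx; nlinarith [sq_nonneg (x - (μ + s))])
      rw [hσs] at h
      rw [div_le_iff₀ (by positivity)]
      have : (u + s) * u ≤ (u + s) * (tail P p * (u + s)) := by nlinarith
      exact le_of_mul_le_mul_left this (by positivity)
    refine le_CR hP hβ hμ hp (by positivity) ?_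
    intro t ht _
    have hTt := tail_nonneg' P t
    by_cases c1 : t ≤ p
    · have hT1 : tail P t ≤ 1 := by
        have := aux_ineq hP (-1) 0 0 (-1) t (by intros; linarith) (by intros; linarith)
        linarith
      calc _ ≤ u / (u + s) * (t * tail P t) := by gcongr; exact min_le_left _ _
        _ ≤ tail P p * (p * 1) := by gcongr
        _ = _ := by ring
    · have c1 := not_le.1 c1
      refine (mul_le_mul_of_nonneg_right (min_le_right _ _) (by positivity)).trans ?_
      rw [div_mul_eq_mul_div, div_le_iff₀ (by positivity), mul_assoc]
      refine mul_le_mul_of_nonneg_left ?_ hp.le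
      by_cases c2 : t ≤ μ + s
      · have := tail_anti hP c1.le
        rw [mul_comm]
        gcongr
      · have c2 := not_le.1 c2
        have h := aux_ineq hP (-p ^ 2) (2 * p) (-1) (-(t - p) ^ 2) t
          (by intro x _ _ hx; nlinarith [sq_nonneg (x - p)]) (by intro x _ _ hx; nlinarith)
        have h' : tail P t * (t - p) ^ 2 ≤ u * (u + s) := by rw [hσs, hμu] at h; linarith
        have g : t * (u + s) ^ 2 ≤ (μ + s) * (t - p) ^ 2 := by
          obtain ⟨r, hr⟩ : ∃ r, r = t - (μ + s) := ⟨_, rfl⟩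
          have hr0 : 0 < r := by linarith
          have : t = p + u + s + r := by linarith
          rw [this, hμu]
          have : 0 ≤ 2 * p * r * (u + s) + p * r ^ 2 + (u + s) * r * (u + s) + (u + s) * r ^ 2 := by positivity
          nlinarith
        have g2 : t * tail P t ≤ (μ + s) * (u / (u + s)) := by
          have htp : 0 < t - p := by linarith
          have : (t * tail P t) * ((t - p) ^ 2 * (u + s)) ≤ ((μ + s) * (u / (u + s))) * ((t - p) ^ 2 * (u + s)) := by
            calc _ = t * (u + s) * (tail P t * (t - p) ^ 2) := by ring
              _ ≤ t * (u + s) * (u * (u + s)) := by gcongr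
              _ = u * (t * (u + s) ^ 2) := by ring
              _ ≤ u * ((μ + s) * (t - p) ^ 2) := by gcongr
              _ = _ := by field_simp
          exact le_of_mul_le_mul_right this (by positivity)
        calc _ ≤ _ := g2
          _ ≤ (μ + s) * tail P p := by gcongr
          _ = _ := by ring

lemma caseB {μ β σ p : ℝ} (hμ : 0 < μ) (hμβ : μ < β) (hσ : 0 < σ) (hσub : σ ^ 2 < μ * (β - μ))
    (hp : 0 < p) (hp1 : μ - σ ^ 2 / (β - μ) ≤ p) (hp2 : p ≤ μ + σ ^ 2 / μ) :
    sInf ((fun P => CR p P) '' ambV μ σ β) =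
          min (p * (μ ^ 2 + σ ^ 2 - p * μ) / ((β - p) * (μ * (β + p - μ) - σ ^ 2)))
              (p / β) := by
  have hβμ : 0 < β - μ := by linarith
  have hβ : 0 < β := by linarith
  have hw : 0 ≤ μ ^ 2 + σ ^ 2 - p * μ := by
    have : (p - μ) * μ ≤ σ ^ 2 := by rw [← le_div_iff₀ hμ]; linarith
    nlinarith
  have hpβ : 0 < β - p := by
    by_contra hc
    nlinarith
  have hD : 0 < μ * (β + p - μ) - σ ^ 2 := by nlinarith
  apply le_antisymm
  · rcases hp1.eq_or_lt with he | hlt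
    · rw [caseA hμ hμβ hσ hσub hp he.ge]
      have hu : 0 < μ - p := by
        have : 0 < σ ^ 2 / (β - μ) := by positivity
        linarith
      have hs : σ ^ 2 = (μ - p) * (β - μ) := by
        rw [← div_eq_iff hβμ.ne']; linarith
      refine le_of_eq ?_
      congr 1
      · rw [div_eq_div_iff (by positivity) (by positivity), hs]; ring
      · rw [div_eq_div_iff (by positivity) (by positivity), hs]; ring
    · have hl : 0 < μ - σ ^ 2 / (β - μ) := by
        have : σ ^ 2 / (β - μ) < μ := by rwa [div_lt_iff₀ hβμ]
        linarith
      have key := lim_upper (S := sInf ((fun P => CR p P) '' ambV μ σ β)) (p := p)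
        (fun y => min (p * ((μ ^ 2 + σ ^ 2 - y * μ) / (β * (β - y))) /
          (y * ((μ * (β - μ) - σ ^ 2) / (y * (β - y)) + (μ ^ 2 + σ ^ 2 - y * μ) / (β * (β - y)))))
          (p / β)) hlt ?_ ?_
      · refine key.trans (le_of_eq ?_)
        congr 1
        have : (μ * (β - μ) - σ ^ 2) / (p * (β - p)) + (μ ^ 2 + σ ^ 2 - p * μ) / (β * (β - p))
          = (μ * (β + p - μ) - σ ^ 2) / (p * β) := by field_simp; ring
        rw [this]
        field_simp
      · have e1 : β * (β - p) ≠ 0 := by positivity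
        have e2 : p * (β - p) ≠ 0 := by positivity
        have e3 : p * ((μ * (β - μ) - σ ^ 2) / (p * (β - p)) + (μ ^ 2 + σ ^ 2 - p * μ) / (β * (β - p))) ≠ 0 := by
          have : 0 < μ * (β - μ) - σ ^ 2 := by linarith
          positivity
        have e4 := hβ.ne'
        fun_prop (disch := assumption)
      · intro y hy hyp
        have hy0 : 0 < y := hl.trans hy
        have hyβ : 0 < β - y := by linarith
        have hb : 0 < μ * (β - μ) - σ ^ 2 := by linarith
        have hc : 0 < μ ^ 2 + σ ^ 2 - y * μ := by nlinarith
        have ha : 0 ≤ σ ^ 2 - (μ - y) * (β - μ) := by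
          have : (μ - y) ≤ σ ^ 2 / (β - μ) := by linarith
          rw [le_div_iff₀ hβμ] at this
          linarith
        refine upper (a := (σ ^ 2 - (μ - y) * (β - μ)) / (y * β)) (by positivity) (by positivity)
          (by positivity) ?_ ?_ ?_ hy0 hyp (by linarith) le_rfl
        · field_simp; ring
        · field_simp; ring
        · field_simp; ring
  · obtain ⟨P0, hP0, -⟩ := nonempty_amb hμ hμβ hσ hσub
    refine le_csInf ⟨_, P0, hP0, rfl⟩ ?_
    rintro _ ⟨P, hP, rfl⟩
    have hT := tail_nonneg' P p
    have q1 := aux_ineq hP 0 (-p) 1 (β * (β - p)) p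
      (by intro x _ _ hx; nlinarith) (by intro x _ _ hx; nlinarith)
    refine le_CR hP hβ hμ hp (by positivity) ?_
    intro t ht htβ
    have hTt := tail_nonneg' P t
    by_cases c1 : t ≤ p
    · refine (mul_le_mul_of_nonneg_right (min_le_left _ _) (by positivity)).trans ?_
      have q2 := aux_ineq hP 0 (-(β + t)) 1 (-(t * β)) t
        (by intro x _ _ hx; nlinarith) (by intro x _ _ hx; nlinarith)
      have q3 : β * (t * tail P t) ≤ μ * (β + p - μ) - σ ^ 2 := by nlinarith
      rw [div_mul_eq_mul_div, div_le_iff₀ (by positivity)]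
      have : β * (p * (μ ^ 2 + σ ^ 2 - p * μ) * (t * tail P t)) ≤
          β * (p * tail P p * ((β - p) * (μ * (β + p - μ) - σ ^ 2))) := by
        calc _ = p * (μ ^ 2 + σ ^ 2 - p * μ) * (β * (t * tail P t)) := by ring
          _ ≤ p * (β * (β - p) * tail P p) * (μ * (β + p - μ) - σ ^ 2) := by
            gcongr
            linarith
          _ = _ := by ring
      exact le_of_mul_le_mul_left this hβ
    · have c1 := not_le.1 c1
      refine (mul_le_mul_of_nonneg_right (min_le_right _ _) (by positivity)).trans ?_
      have := tail_anti hP c1.le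
      rw [div_mul_eq_mul_div, div_le_iff₀ (by positivity)]
      calc p * (t * tail P t) ≤ p * (β * tail P p) := by gcongr
        _ = _ := by ring

/-- **Explicit worst-case competitive ratio under mean–variance–support information**:
with `τ₁ = μ − σ²/(β−μ)` and `τ₂ = μ + σ²/μ`, the tight lower bound of the competitive
ratio is given branchwise in closed form. -/
theorem worst_case_CR_mean_variance_support
    (μ β σ : ℝ) (hμ : 0 < μ) (hμβ : μ < β) (hσ : 0 < σ) (hσub : σ ^ 2 < μ * (β - μ)) :
    ∀ p ∈ Ioc (0:ℝ) β,
      (p ≤ μ - σ ^ 2 / (β - μ) →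
        sInf ((fun P => CR p P) '' ambV μ σ β) =
          min ((μ - p) ^ 2 / ((μ - p) ^ 2 + σ ^ 2))
              (p * (μ - p) / (μ * (μ - p) + σ ^ 2))) ∧
      (μ - σ ^ 2 / (β - μ) ≤ p → p ≤ μ + σ ^ 2 / μ →
        sInf ((fun P => CR p P) '' ambV μ σ β) =
          min (p * (μ ^ 2 + σ ^ 2 - p * μ) / ((β - p) * (μ * (β + p - μ) - σ ^ 2)))
              (p / β)) ∧
      (μ + σ ^ 2 / μ ≤ p →
        sInf ((fun P => CR p P) '' ambV μ σ β) = 0) := by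
  rintro p ⟨hp, hpβ⟩
  refine ⟨caseA hμ hμβ hσ hσub hp, caseB hμ hμβ hσ hσub hp, fun h => ?_⟩
  rcases h.eq_or_lt with he | hlt
  · have h1 : μ - σ ^ 2 / (β - μ) ≤ p := by
      have : 0 ≤ σ ^ 2 / (β - μ) := div_nonneg (sq_nonneg _) (by linarith)
      have : 0 ≤ σ ^ 2 / μ := by positivity
      linarith
    rw [caseB hμ hμβ hσ hσub hp h1 he.ge]
    have : μ ^ 2 + σ ^ 2 - p * μ = 0 := by rw [← he]; field_simp; ring
    rw [this]
    have : 0 ≤ p / β := div_nonneg hp.le (by linarith)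
    simpa using this
  · obtain ⟨P, hP, ht⟩ := nonempty_amb hμ hμβ hσ hσub
    apply le_antisymm
    · refine (sInf_le_CR hP hp).trans (le_of_eq ?_)
      simp [CR, REV, ht p hlt]
    · refine le_csInf ⟨_, P, hP, rfl⟩ ?_
      rintro _ ⟨Q, _, rfl⟩
      exact CR_nonneg Q hp
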